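/- arXiv:1711.08232 — 2 statements merged into one kernel-verified Lean document; each statement's English description precedes it below -/
import Mathlib

section
/- Let n ≥ 2 be an integer, s ∈ (1/2, 1), Σ ⊆ ℝ^{n+1} a set with locally finite ℋⁿ-measure, and Ω ⊆ ℝ^{n+1} an open set. Suppose that ℋⁿ(Σ ∩ B_ρ(x)) ≤ C⋆ ρⁿ for every x ∈ Σ ∩ Ω and ρ ∈ (0, R], for some positive constants R and C⋆. Then there exists a constant C depending only on n, s, and C⋆, such that Cap_{Σ∩Ω, s}(A) ≤ C · ℋ^{n−2s}(A) for every set A ⊆ Σ ∩ Ω. -/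
open MeasureTheory Metric Set
open scoped ENNReal NNReal

noncomputable section

/-- The squared `H^s(T)` norm `‖v‖²_{H^s(T)} = ∫_T v² + [v]²_{H^s(T)}` on an
`ℋⁿ`-measurable subset `T` of `ℝ^{n+1}`. -/
def sobolevNormSq (n : ℕ) (s : ℝ) (T : Set (EuclideanSpace ℝ (Fin (n + 1))))
    (v : EuclideanSpace ℝ (Fin (n + 1)) → ℝ) : ℝ≥0∞ :=
  (∫⁻ x in T, ENNReal.ofReal ((v x) ^ 2) ∂μH[(n : ℝ)]) +
    ∫⁻ x in T, ∫⁻ y in T,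
      ENNReal.ofReal ((v x - v y) ^ 2 * ‖x - y‖ ^ (-((n : ℝ) + 2 * s)))
        ∂μH[(n : ℝ)] ∂μH[(n : ℝ)]

/-- The `s`-fractional capacity of `A` on the set `T ⊆ ℝ^{n+1}`: the infimum of
`‖v‖²_{H^s(T)}` over measurable `v` of finite norm with `v ≥ 1` `ℋⁿ`-a.e. in an open
neighborhood of `A`. -/
def fracCapacity (n : ℕ) (s : ℝ) (T A : Set (EuclideanSpace ℝ (Fin (n + 1)))) : ℝ≥0∞ :=
  ⨅ (v : EuclideanSpace ℝ (Fin (n + 1)) → ℝ)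
    (_ : Measurable v ∧ sobolevNormSq n s T v ≠ ⊤ ∧
      ∃ N : Set (EuclideanSpace ℝ (Fin (n + 1))), IsOpen N ∧ A ⊆ N ∧
        ∀ᵐ x ∂(μH[(n : ℝ)].restrict (T ∩ N)), 1 ≤ v x),
    sobolevNormSq n s T v

theorem measure_ball_le_of_forall_measure_ball_le {E : Type*} [NormedAddCommGroup E]
    [NormedSpace ℝ E] [FiniteDimensional ℝ E] [Nontrivial E] [MeasurableSpace E] [BorelSpace E]
    (μ : Measure E) [SFinite μ] {r ρ : ℝ} (hr : 0 < r) (hρ : r ≤ ρ) {K : ℝ≥0∞}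
    (hK : ∀ z, μ (ball z r) ≤ K) (x : E) :
    μ (ball x ρ) ≤ ENNReal.ofReal ((2 * ρ / r) ^ Module.finrank ℝ E) * K := by
  let ν : Measure E := Measure.addHaar
  have hms : MeasurableSet {w : E × E | dist w.1 w.2 < r} :=
    (isOpen_lt continuous_dist continuous_const).measurableSet
  have hswap :
      ∫⁻ y in ball x ρ, ∫⁻ z in ball x (2 * ρ), {w : E × E | dist w.1 w.2 < r}.indicator 1 (y, z) ∂ν ∂μ
      = ∫⁻ z in ball x (2 * ρ), ∫⁻ y in ball x ρ,
        {w : E × E | dist w.1 w.2 < r}.indicator 1 (y, z) ∂μ ∂ν := by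
    apply lintegral_lintegral_swap
    exact (measurable_one.indicator hms).aemeasurable
  have hleft : ν (ball 0 r) * μ (ball x ρ) ≤
      ∫⁻ y in ball x ρ, ∫⁻ z in ball x (2 * ρ),
        {w : E × E | dist w.1 w.2 < r}.indicator 1 (y, z) ∂ν ∂μ := by
    rw [← setLIntegral_const]
    refine setLIntegral_mono' measurableSet_ball fun y hy => ?_
    have h1 : ball y r ⊆ ball x (2 * ρ) :=
      ball_subset_ball' (by have := mem_ball.1 hy; linarith)
    calc ν (ball 0 r) = ν (ball y r) := by
          rw [Measure.addHaar_ball ν y hr.le, Measure.addHaar_ball ν 0 hr.le]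
      _ = ν.restrict (ball x (2 * ρ)) (ball y r) := by
          rw [Measure.restrict_apply measurableSet_ball, inter_eq_left.2 h1]
      _ = ∫⁻ z in ball x (2 * ρ), (ball y r).indicator 1 z ∂ν :=
          (lintegral_indicator_one measurableSet_ball).symm
      _ ≤ _ := lintegral_mono fun z => by
          simp [indicator, dist_comm]
  have hright : ∫⁻ z in ball x (2 * ρ), ∫⁻ y in ball x ρ,
        {w : E × E | dist w.1 w.2 < r}.indicator 1 (y, z) ∂μ ∂ν ≤ K * ν (ball x (2 * ρ)) := by
    rw [← setLIntegral_const]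
    refine lintegral_mono fun z => ?_
    calc ∫⁻ y in ball x ρ, {w : E × E | dist w.1 w.2 < r}.indicator 1 (y, z) ∂μ
        ≤ ∫⁻ y, (ball z r).indicator 1 y ∂μ := by
          refine (setLIntegral_le_lintegral _ _).trans (lintegral_mono fun y => ?_)
          simp [indicator]
      _ = μ (ball z r) := lintegral_indicator_one measurableSet_ball
      _ ≤ K := hK z
  have hmain := hleft.trans (hswap.le.trans hright)
  have hd : 0 < r ^ Module.finrank ℝ E := by positivity
  have h0 : ν (ball 0 1) ≠ 0 := (measure_ball_pos ν 0 one_pos).ne'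
  have ht : ν (ball 0 1) ≠ ⊤ := measure_ball_lt_top.ne
  rw [Measure.addHaar_ball ν x (by linarith), Measure.addHaar_ball ν 0 hr.le] at hmain
  rw [div_pow, ENNReal.ofReal_div_of_pos hd]
  have h2 : ENNReal.ofReal (r ^ Module.finrank ℝ E) * μ (ball x ρ) ≤
      ENNReal.ofReal ((2 * ρ) ^ Module.finrank ℝ E) * K := by
    rw [← ENNReal.mul_le_mul_iff_left h0 ht]
    convert! hmain using 1 <;> ring
  rw [← ENNReal.mul_div_right_comm, ENNReal.le_div_iff_mul_le (by simp [hd]) (by simp), mul_comm]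
  exact h2

theorem tsum_ofReal_geometric {a q : ℝ} (ha : 0 ≤ a) (hq : 0 ≤ q) (hq1 : q < 1) :
    ∑' j : ℕ, ENNReal.ofReal (a * q ^ j) = ENNReal.ofReal (a / (1 - q)) := by
  rw [← ENNReal.ofReal_tsum_of_nonneg (fun j => by positivity)
    ((summable_geometric_of_lt_one hq hq1).mul_left a), tsum_mul_left,
    tsum_geometric_of_lt_one hq hq1, div_eq_mul_inv]

theorem min_sq_mul_rpow_near {p t r : ℝ} (hp : 0 ≤ p) (hr : 0 < r) (ht : 0 < t) (htr : t < r) :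
    ∃ j : ℕ, t < (1 / 2) ^ j * (2 * r) ∧
      min 1 ((t / r) ^ 2) * t ^ (-p) ≤ ((1 / 2) ^ j) ^ 2 * ((1 / 2) ^ (j + 1) * r) ^ (-p) := by
  obtain ⟨j, hj1, hj2⟩ := exists_nat_pow_near_of_lt_one (x := t / r) (y := 1 / 2) (by positivity)
    ((div_le_one hr).2 htr.le) (by norm_num) (by norm_num)
  rw [lt_div_iff₀ hr] at hj1
  have hj3 := (div_le_iff₀ hr).1 hj2
  refine ⟨j, ?_, ?_⟩
  · have : 0 < (1 / 2 : ℝ) ^ j * r := by positivity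
    linarith
  · refine mul_le_mul ((min_le_right _ _).trans (by gcongr))
      (Real.rpow_le_rpow_of_nonpos (by positivity) hj1.le (by linarith)) (by positivity)
      (by positivity)

theorem min_sq_mul_rpow_far {p t r : ℝ} (hp : 0 ≤ p) (hr : 0 < r) (htr : r ≤ t) :
    ∃ j : ℕ, t < 2 ^ (j + 1) * r ∧ min 1 ((t / r) ^ 2) * t ^ (-p) ≤ (2 ^ j * r) ^ (-p) := by
  have ht : 0 < t := hr.trans_le htr
  obtain ⟨j, hj1, hj2⟩ := exists_nat_pow_near (x := t / r) (y := 2)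
    ((one_le_div hr).2 htr) (by norm_num)
  rw [le_div_iff₀ hr] at hj1
  rw [div_lt_iff₀ hr] at hj2
  refine ⟨j, hj2, ?_⟩
  calc min 1 ((t / r) ^ 2) * t ^ (-p) ≤ 1 * t ^ (-p) := by gcongr; exact min_le_left _ _
    _ = t ^ (-p) := one_mul _
    _ ≤ _ := Real.rpow_le_rpow_of_nonpos (by positivity) hj1 (by linarith)

/-- The constant in `lintegral_kernel_le`. -/
def kernelConst (n : ℕ) (s M : ℝ) : ℝ :=
  M * 2 ^ n * 2 ^ ((n : ℝ) + 2 * s) / (1 - (1 / 2) ^ (2 - 2 * s)) +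
    M * 4 ^ (n + 1) / (1 - 2 ^ (1 - 2 * s))

theorem near_term_eq {n : ℕ} {s M r : ℝ} (hr : 0 < r) (j : ℕ) :
    ((1 / 2) ^ j) ^ 2 * ((1 / 2) ^ (j + 1) * r) ^ (-((n : ℝ) + 2 * s)) *
      (M * ((1 / 2) ^ j * (2 * r)) ^ n) =
    M * 2 ^ n * 2 ^ ((n : ℝ) + 2 * s) * r ^ (-(2 * s)) * ((1 / 2) ^ (2 - 2 * s)) ^ j := by
  have e1 : ((1 / 2 : ℝ) ^ (2 - 2 * s)) ^ j = ((1 / 2 : ℝ) ^ j) ^ (2 - 2 * s) := by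
    rw [← Real.rpow_natCast, ← Real.rpow_natCast, ← Real.rpow_mul (by norm_num),
      ← Real.rpow_mul (by norm_num), mul_comm]
  have hu : 0 < (1 / 2 : ℝ) ^ j := by positivity
  rw [e1, pow_succ (1 / 2 : ℝ) j]
  generalize (1 / 2 : ℝ) ^ j = u at hu
  have e2 : u ^ (2 - 2 * s) = u ^ 2 * u ^ (-((n : ℝ) + 2 * s)) * u ^ n := by
    rw [← Real.rpow_natCast u n, ← Real.rpow_natCast u 2, ← Real.rpow_add hu, ← Real.rpow_add hu]
    congr 1
    push_cast
    ring
  have e3 : r ^ (-(2 * s)) = r ^ (-((n : ℝ) + 2 * s)) * r ^ n := by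
    rw [← Real.rpow_natCast r n, ← Real.rpow_add hr]
    congr 1
    ring
  rw [e2, e3, Real.mul_rpow (by positivity) hr.le, Real.mul_rpow hu.le (by norm_num),
    mul_pow, mul_pow, one_div, Real.inv_rpow zero_le_two, Real.rpow_neg zero_le_two, inv_inv]
  ring

theorem far_term_eq {n : ℕ} {s M r : ℝ} (hr : 0 < r) (j : ℕ) :
    (2 ^ j * r) ^ (-((n : ℝ) + 2 * s)) *
      ((2 * (2 ^ (j + 1) * r) / r) ^ (n + 1) * (M * r ^ n)) =
    M * 4 ^ (n + 1) * r ^ (-(2 * s)) * (2 ^ (1 - 2 * s)) ^ j := by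
  have e1 : ((2 : ℝ) ^ (1 - 2 * s)) ^ j = ((2 : ℝ) ^ j) ^ (1 - 2 * s) := by
    rw [← Real.rpow_natCast, ← Real.rpow_natCast, ← Real.rpow_mul (by norm_num),
      ← Real.rpow_mul (by norm_num), mul_comm]
  have hu : 0 < (2 : ℝ) ^ j := by positivity
  rw [e1, pow_succ (2 : ℝ) j]
  generalize (2 : ℝ) ^ j = u at hu
  have e2 : u ^ (1 - 2 * s) = u ^ (-((n : ℝ) + 2 * s)) * u ^ (n + 1) := by
    rw [← Real.rpow_natCast u (n + 1), ← Real.rpow_add hu]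
    congr 1
    push_cast
    ring
  have e3 : r ^ (-(2 * s)) = r ^ (-((n : ℝ) + 2 * s)) * r ^ n := by
    rw [← Real.rpow_natCast r n, ← Real.rpow_add hr]
    congr 1
    ring
  have e4 : 2 * (u * 2 * r) / r = 4 * u := by field_simp; norm_num
  rw [e2, e3, e4, Real.mul_rpow hu.le hr.le, mul_pow]
  ring

theorem lintegral_kernel_le {n : ℕ} {s : ℝ} (hs : s ∈ Ioo (1 / 2 : ℝ) 1)
    (μ : Measure (EuclideanSpace ℝ (Fin (n + 1)))) [SFinite μ] {M r : ℝ} (hM : 0 ≤ M) (hr : 0 < r)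
    (hμ : ∀ x, ∀ ρ ∈ Ioc 0 (2 * r), μ (ball x ρ) ≤ ENNReal.ofReal (M * ρ ^ n))
    (x : EuclideanSpace ℝ (Fin (n + 1))) :
    ∫⁻ y, ENNReal.ofReal (min 1 ((‖x - y‖ / r) ^ 2) * ‖x - y‖ ^ (-((n : ℝ) + 2 * s))) ∂μ ≤
      ENNReal.ofReal (kernelConst n s M * r ^ (-(2 * s))) := by
  obtain ⟨hs1, hs2⟩ := hs
  set p : ℝ := (n : ℝ) + 2 * s with hp
  have hp0 : 0 < p := by positivity
  let a : ℕ → ℝ := fun j => ((1 / 2) ^ j) ^ 2 * ((1 / 2) ^ (j + 1) * r) ^ (-p)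
  let b : ℕ → ℝ := fun j => (2 ^ j * r) ^ (-p)
  have ha : ∀ j, 0 ≤ a j := fun j => by positivity
  have hb : ∀ j, 0 ≤ b j := fun j => by positivity
  let U : ℕ → Set (EuclideanSpace ℝ (Fin (n + 1))) := fun j => ball x ((1 / 2) ^ j * (2 * r))
  let V : ℕ → Set (EuclideanSpace ℝ (Fin (n + 1))) := fun j => ball x (2 ^ (j + 1) * r)
  have hpt : ∀ y, ENNReal.ofReal (min 1 ((‖x - y‖ / r) ^ 2) * ‖x - y‖ ^ (-p)) ≤
      ∑' j, (U j).indicator (fun _ => ENNReal.ofReal (a j)) y +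
        ∑' j, (V j).indicator (fun _ => ENNReal.ofReal (b j)) y := by
    intro y
    rcases (norm_nonneg (x - y)).eq_or_lt with h0 | h0
    · rw [← h0, Real.zero_rpow (by linarith)]
      simp
    rcases lt_or_ge ‖x - y‖ r with h | h
    · obtain ⟨j, hj1, hj2⟩ := min_sq_mul_rpow_near hp0.le hr h0 h
      have hy : y ∈ U j := by simpa [U, mem_ball, dist_comm, dist_eq_norm] using hj1
      refine le_trans ?_ le_self_add
      refine le_trans ?_ (ENNReal.le_tsum j)
      rw [indicator_of_mem hy]
      exact ENNReal.ofReal_le_ofReal hj2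
    · obtain ⟨j, hj1, hj2⟩ := min_sq_mul_rpow_far hp0.le hr h
      have hy : y ∈ V j := by
        rw [mem_ball, dist_comm, dist_eq_norm]
        exact hj1
      refine le_trans ?_ le_add_self
      refine le_trans ?_ (ENNReal.le_tsum j)
      rw [indicator_of_mem hy]
      exact ENNReal.ofReal_le_ofReal hj2
  have hq1 : (1 / 2 : ℝ) ^ (2 - 2 * s) < 1 :=
    Real.rpow_lt_one (by norm_num) (by norm_num) (by linarith)
  have hq2 : (2 : ℝ) ^ (1 - 2 * s) < 1 :=
    Real.rpow_lt_one_of_one_lt_of_neg (by norm_num) (by linarith)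
  have hnear : ∀ j, ENNReal.ofReal (a j) * μ (U j) ≤ ENNReal.ofReal
      (M * 2 ^ n * 2 ^ p * r ^ (-(2 * s)) * ((1 / 2) ^ (2 - 2 * s)) ^ j) := by
    intro j
    rw [← near_term_eq hr j, ENNReal.ofReal_mul (ha j)]
    gcongr
    refine hμ x _ ⟨by positivity, ?_⟩
    exact mul_le_of_le_one_left (by positivity) (pow_le_one₀ (by norm_num) (by norm_num))
  have hfar : ∀ j, ENNReal.ofReal (b j) * μ (V j) ≤ ENNReal.ofReal
      (M * 4 ^ (n + 1) * r ^ (-(2 * s)) * (2 ^ (1 - 2 * s)) ^ j) := by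
    intro j
    rw [← far_term_eq hr j, ENNReal.ofReal_mul (hb j), ENNReal.ofReal_mul (by positivity)]
    gcongr
    have h := measure_ball_le_of_forall_measure_ball_le μ hr (ρ := 2 ^ (j + 1) * r)
      (le_mul_of_one_le_left hr.le (one_le_pow₀ one_le_two))
      (fun z => hμ z r ⟨hr, by linarith⟩) x
    rwa [finrank_euclideanSpace_fin] at h
  calc _ ≤ ∫⁻ y, (∑' j, (U j).indicator (fun _ => ENNReal.ofReal (a j)) y +
        ∑' j, (V j).indicator (fun _ => ENNReal.ofReal (b j)) y) ∂μ := lintegral_mono hpt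
    _ = ∑' j, ENNReal.ofReal (a j) * μ (U j) + ∑' j, ENNReal.ofReal (b j) * μ (V j) := by
      have hU : ∀ j, Measurable ((U j).indicator fun _ => ENNReal.ofReal (a j)) :=
        fun j => measurable_const.indicator measurableSet_ball
      have hV : ∀ j, Measurable ((V j).indicator fun _ => ENNReal.ofReal (b j)) :=
        fun j => measurable_const.indicator measurableSet_ball
      rw [lintegral_add_left (Measurable.tsum hU),
        lintegral_tsum fun j => (hU j).aemeasurable, lintegral_tsum fun j => (hV j).aemeasurable]
      exact congrArg₂ _ (tsum_congr fun j => lintegral_indicator_const measurableSet_ball _)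
        (tsum_congr fun j => lintegral_indicator_const measurableSet_ball _)
    _ ≤ _ := add_le_add (ENNReal.tsum_le_tsum hnear) (ENNReal.tsum_le_tsum hfar)
    _ = _ := by
      rw [tsum_ofReal_geometric (by positivity) (by positivity) hq1,
        tsum_ofReal_geometric (by positivity) (by positivity) hq2, ← ENNReal.ofReal_add]
      · congr 1
        rw [kernelConst, ← hp]
        ring
      · exact div_nonneg (by positivity) (by linarith)
      · exact div_nonneg (by positivity) (by linarith)

/-- The radial cutoff which is `1` on the ball of radius `r` around `c` and vanishes outside the
ball of radius `2 * r`. -/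
def cutoff {X : Type*} [PseudoMetricSpace X] (c : X) (r : ℝ) (x : X) : ℝ :=
  max 0 (min 1 (2 - dist x c / r))

section cutoff

variable {X : Type*} [PseudoMetricSpace X] (c : X) (r : ℝ)

theorem continuous_cutoff : Continuous (cutoff c r) := by
  unfold cutoff
  fun_prop

theorem cutoff_nonneg (x : X) : 0 ≤ cutoff c r x := le_max_left _ _

theorem cutoff_le_one (x : X) : cutoff c r x ≤ 1 := max_le zero_le_one (min_le_left _ _)

variable {c r}

theorem cutoff_eq_one (hr : 0 < r) {x : X} (hx : x ∈ ball c r) : cutoff c r x = 1 := by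
  have : dist x c / r ≤ 1 := (div_le_one hr).2 (mem_ball.1 hx).le
  rw [cutoff, min_eq_left (by linarith), max_eq_right zero_le_one]

theorem cutoff_eq_zero (hr : 0 < r) {x : X} (hx : x ∉ ball c (2 * r)) : cutoff c r x = 0 := by
  have : 2 ≤ dist x c / r := (le_div_iff₀ hr).2 (not_lt.1 hx)
  exact max_eq_left ((min_le_right _ _).trans (by linarith))

theorem sq_cutoff_sub_le (hr : 0 < r) (x y : X) :
    (cutoff c r x - cutoff c r y) ^ 2 ≤ min 1 ((dist x y / r) ^ 2) := by
  refine le_min ?_ ?_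
  · rw [sq_le_one_iff_abs_le_one, abs_le]
    constructor <;> linarith [cutoff_nonneg c r x, cutoff_nonneg c r y, cutoff_le_one c r x,
      cutoff_le_one c r y]
  · rw [← sq_abs (cutoff c r x - cutoff c r y)]
    gcongr
    calc |cutoff c r x - cutoff c r y|
        ≤ |min 1 (2 - dist x c / r) - min 1 (2 - dist y c / r)| := by
          simpa only [cutoff, max_comm (0 : ℝ)] using abs_max_sub_max_le_abs _ _ (0 : ℝ)
      _ ≤ max |1 - 1| |2 - dist x c / r - (2 - dist y c / r)| := abs_min_sub_min_le_max _ _ _ _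
      _ = |dist x c - dist y c| / r := by
          rw [sub_self, abs_zero, max_eq_right (abs_nonneg _), sub_sub_sub_cancel_left, ← sub_div,
            abs_div, abs_of_pos hr, abs_sub_comm]
      _ ≤ dist x y / r := by gcongr; exact abs_dist_sub_le x y c

end cutoff

/-- The constant in `sobolevNormSq_cutoff_le`. -/
def cutoffConst (n : ℕ) (s M : ℝ) : ℝ := M * 2 ^ n * (1 + 2 * kernelConst n s M)

theorem kernelConst_nonneg {n : ℕ} {s M : ℝ} (hs : s ∈ Ioo (1 / 2 : ℝ) 1) (hM : 0 ≤ M) :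
    0 ≤ kernelConst n s M := by
  have hq1 : (1 / 2 : ℝ) ^ (2 - 2 * s) < 1 :=
    Real.rpow_lt_one (by norm_num) (by norm_num) (by linarith [hs.2])
  have hq2 : (2 : ℝ) ^ (1 - 2 * s) < 1 :=
    Real.rpow_lt_one_of_one_lt_of_neg (by norm_num) (by linarith [hs.1])
  exact add_nonneg (div_nonneg (by positivity) (by linarith))
    (div_nonneg (by positivity) (by linarith))

theorem sobolevNormSq_cutoff_le {n : ℕ} {s : ℝ} (hs : s ∈ Ioo (1 / 2 : ℝ) 1)
    (T : Set (EuclideanSpace ℝ (Fin (n + 1)))) [SFinite (μH[(n : ℝ)].restrict T)]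
    {M r : ℝ} (hM : 0 ≤ M) (hr : r ∈ Ioc (0 : ℝ) 1)
    (hT : ∀ x, ∀ ρ ∈ Ioc 0 (2 * r),
      μH[(n : ℝ)].restrict T (ball x ρ) ≤ ENNReal.ofReal (M * ρ ^ n))
    (c : EuclideanSpace ℝ (Fin (n + 1))) :
    sobolevNormSq n s T (cutoff c r) ≤
      ENNReal.ofReal (cutoffConst n s M) * ENNReal.ofReal (r ^ ((n : ℝ) - 2 * s)) := by
  obtain ⟨hr, hr1⟩ := hr
  rw [sobolevNormSq]
  set μ := (μH[(n : ℝ)]).restrict T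
  set K := kernelConst n s M with hK
  have hK0 : 0 ≤ K := kernelConst_nonneg hs hM
  set B := ball c (2 * r)
  let χ : EuclideanSpace ℝ (Fin (n + 1)) → ℝ≥0∞ := B.indicator 1
  have hχ : Measurable χ := measurable_one.indicator measurableSet_ball
  let k : EuclideanSpace ℝ (Fin (n + 1)) → EuclideanSpace ℝ (Fin (n + 1)) → ℝ≥0∞ :=
    fun x y => ENNReal.ofReal (min 1 ((‖x - y‖ / r) ^ 2) * ‖x - y‖ ^ (-((n : ℝ) + 2 * s)))
  have hk : Measurable (Function.uncurry k) := by
    simp only [k, Function.uncurry_def]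
    fun_prop
  have hksymm : ∀ x y, k x y = k y x := fun x y => by simp only [k, norm_sub_rev]
  have hkint : ∀ x, ∫⁻ y, k x y ∂μ ≤ ENNReal.ofReal (K * r ^ (-(2 * s))) :=
    lintegral_kernel_le hs μ hM hr hT
  have hB : μ B ≤ ENNReal.ofReal (M * (2 * r) ^ n) := hT c _ ⟨by positivity, le_rfl⟩
  have hL2 : ∫⁻ x, ENNReal.ofReal (cutoff c r x ^ 2) ∂μ ≤ μ B := by
    rw [← lintegral_indicator_one measurableSet_ball]
    refine lintegral_mono fun x => ?_
    by_cases hx : x ∈ B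
    · rw [indicator_of_mem hx, Pi.one_apply, ENNReal.ofReal_le_one]
      exact pow_le_one₀ (cutoff_nonneg c r x) (cutoff_le_one c r x)
    · simp [cutoff_eq_zero hr hx]
  have hpt : ∀ x y, ENNReal.ofReal
      ((cutoff c r x - cutoff c r y) ^ 2 * ‖x - y‖ ^ (-((n : ℝ) + 2 * s))) ≤
      χ x * k x y + χ y * k x y := by
    intro x y
    have h : ENNReal.ofReal
        ((cutoff c r x - cutoff c r y) ^ 2 * ‖x - y‖ ^ (-((n : ℝ) + 2 * s))) ≤ k x y := by
      refine ENNReal.ofReal_le_ofReal (mul_le_mul_of_nonneg_right ?_ (by positivity))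
      rw [← dist_eq_norm]
      exact sq_cutoff_sub_le hr x y
    by_cases hx : x ∈ B
    · refine le_trans ?_ le_self_add
      simpa [χ, hx] using h
    by_cases hy : y ∈ B
    · refine le_trans ?_ le_add_self
      simpa [χ, hy] using h
    simp [cutoff_eq_zero hr hx, cutoff_eq_zero hr hy]
  have hχk : ∫⁻ x, ∫⁻ y, χ x * k x y ∂μ ∂μ ≤ μ B * ENNReal.ofReal (K * r ^ (-(2 * s))) := by
    calc ∫⁻ x, ∫⁻ y, χ x * k x y ∂μ ∂μ = ∫⁻ x, χ x * ∫⁻ y, k x y ∂μ ∂μ :=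
          lintegral_congr fun x => lintegral_const_mul _ (hk.of_uncurry_left)
      _ ≤ ∫⁻ x, χ x * ENNReal.ofReal (K * r ^ (-(2 * s))) ∂μ :=
          lintegral_mono fun x => mul_le_mul_right (hkint x) _
      _ = _ := by rw [lintegral_mul_const _ hχ, lintegral_indicator_one measurableSet_ball]
  have hχk' : ∫⁻ x, ∫⁻ y, χ y * k x y ∂μ ∂μ ≤ μ B * ENNReal.ofReal (K * r ^ (-(2 * s))) := by
    rw [lintegral_lintegral_swap ((hχ.comp measurable_snd).mul hk).aemeasurable]
    simpa only [fun x y => hksymm y x] using hχk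
  have hmeas : Measurable (Function.uncurry fun x y => χ x * k x y) :=
    (hχ.comp measurable_fst).mul hk
  have hsemi := calc
    ∫⁻ x, ∫⁻ y, ENNReal.ofReal
      ((cutoff c r x - cutoff c r y) ^ 2 * ‖x - y‖ ^ (-((n : ℝ) + 2 * s))) ∂μ ∂μ
      ≤ ∫⁻ x, ∫⁻ y, (χ x * k x y + χ y * k x y) ∂μ ∂μ :=
        lintegral_mono fun x => lintegral_mono fun y => hpt x y
    _ = ∫⁻ x, ∫⁻ y, χ x * k x y ∂μ ∂μ + ∫⁻ x, ∫⁻ y, χ y * k x y ∂μ ∂μ := by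
        rw [← lintegral_add_left hmeas.lintegral_prod_right]
        exact lintegral_congr fun x => lintegral_add_left hmeas.of_uncurry_left _
    _ ≤ _ := add_le_add hχk hχk'
  have hrpow : r ^ n * r ^ (-(2 * s)) = r ^ ((n : ℝ) - 2 * s) := by
    rw [← Real.rpow_natCast r n, ← Real.rpow_add hr, sub_eq_add_neg]
  have hrn : r ^ n ≤ r ^ ((n : ℝ) - 2 * s) := by
    rw [← Real.rpow_natCast r n]
    exact Real.rpow_le_rpow_of_exponent_ge hr hr1 (by linarith [hs.1])
  calc _ ≤ μ B + (μ B * ENNReal.ofReal (K * r ^ (-(2 * s))) +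
        μ B * ENNReal.ofReal (K * r ^ (-(2 * s)))) := add_le_add hL2 hsemi
    _ ≤ ENNReal.ofReal (M * (2 * r) ^ n) +
        (ENNReal.ofReal (M * (2 * r) ^ n) * ENNReal.ofReal (K * r ^ (-(2 * s))) +
        ENNReal.ofReal (M * (2 * r) ^ n) * ENNReal.ofReal (K * r ^ (-(2 * s)))) := by gcongr
    _ = ENNReal.ofReal (M * 2 ^ n * (r ^ n + 2 * K * (r ^ n * r ^ (-(2 * s))))) := by
        rw [← ENNReal.ofReal_mul (by positivity), ← ENNReal.ofReal_add (by positivity)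
          (by positivity), ← ENNReal.ofReal_add (by positivity) (by positivity)]
        congr 1
        rw [mul_pow]
        ring
    _ ≤ _ := by
        rw [← ENNReal.ofReal_mul (by rw [cutoffConst]; positivity), cutoffConst, hrpow, ← hK,
          mul_assoc _ (1 + 2 * K), add_mul, one_mul]
        gcongr

theorem ofReal_sq_iSup_sub_iSup_le {a b : ℕ → ℝ} (ha : BddAbove (range a))
    (hb : BddAbove (range b)) :
    ENNReal.ofReal ((iSup a - iSup b) ^ 2) ≤ ∑' i, ENNReal.ofReal ((a i - b i) ^ 2) := by
  set S := ∑' i, ENNReal.ofReal ((a i - b i) ^ 2) with hS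
  rcases eq_or_ne S ⊤ with h | h
  · simp [h]
  have hi : ∀ i, |a i - b i| ≤ √S.toReal := fun i => by
    refine Real.abs_le_sqrt ?_
    rw [← ENNReal.ofReal_le_iff_le_toReal h]
    exact ENNReal.le_tsum i
  refine ENNReal.ofReal_le_of_le_toReal ?_
  rw [← Real.sq_sqrt S.toReal_nonneg, sq_le_sq, abs_of_nonneg (Real.sqrt_nonneg S.toReal),
    abs_le]
  constructor
  · suffices iSup b ≤ iSup a + √S.toReal by linarith
    exact ciSup_le fun i => by linarith [(abs_le.1 (hi i)).1, le_ciSup ha i]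
  · suffices iSup a ≤ iSup b + √S.toReal by linarith
    exact ciSup_le fun i => by linarith [(abs_le.1 (hi i)).2, le_ciSup hb i]

theorem sobolevNormSq_iSup_le (n : ℕ) (s : ℝ) (T : Set (EuclideanSpace ℝ (Fin (n + 1))))
    [SFinite (μH[(n : ℝ)].restrict T)] {v : ℕ → EuclideanSpace ℝ (Fin (n + 1)) → ℝ}
    (hv : ∀ i, Measurable (v i)) (hbdd : ∀ x, BddAbove (range fun i => v i x)) :
    sobolevNormSq n s T (fun x => ⨆ i, v i x) ≤ ∑' i, sobolevNormSq n s T (v i) := by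
  simp only [sobolevNormSq]
  rw [ENNReal.tsum_add]
  have hmeas : ∀ i, Measurable (Function.uncurry fun x y => ENNReal.ofReal
      ((v i x - v i y) ^ 2 * ‖x - y‖ ^ (-((n : ℝ) + 2 * s)))) := fun i => by
    simp only [Function.uncurry_def]
    fun_prop
  refine add_le_add ?_ ?_
  · rw [← lintegral_tsum fun i => ((hv i).pow_const 2).ennreal_ofReal.aemeasurable]
    refine lintegral_mono fun x => ?_
    simpa using ofReal_sq_iSup_sub_iSup_le (hbdd x) (b := fun _ => 0) ⟨0, by simp [upperBounds]⟩
  · rw [← lintegral_tsum fun i => (hmeas i).lintegral_prod_right.aemeasurable]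
    refine lintegral_mono fun x => ?_
    rw [← lintegral_tsum fun i => (hmeas i).of_uncurry_left.aemeasurable]
    refine lintegral_mono fun y => ?_
    simp_rw [ENNReal.ofReal_mul (sq_nonneg _), ENNReal.tsum_mul_right]
    gcongr
    exact ofReal_sq_iSup_sub_iSup_le (hbdd x) (hbdd y)

theorem exists_radius_rpow_le {d δ : ℝ} (hd : 0 < d) {D ε : ℝ≥0∞} (hε : ε ≠ 0)
    (hD : D < ENNReal.ofReal δ) :
    ∃ r ∈ Ioc 0 δ, D < ENNReal.ofReal r ∧ ENNReal.ofReal (r ^ d) ≤ D ^ d + ε := by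
  have hDt : D ≠ ⊤ := hD.ne_top
  have hD' : D.toReal < δ := (ENNReal.lt_ofReal_iff_toReal_lt hDt).1 hD
  have hcont : Filter.Tendsto (fun r : ℝ => ENNReal.ofReal (r ^ d)) (nhds D.toReal)
      (nhds (D ^ d)) := by
    have h : ENNReal.ofReal (D.toReal ^ d) = D ^ d := by
      rw [← ENNReal.ofReal_rpow_of_nonneg D.toReal_nonneg hd.le, ENNReal.ofReal_toReal hDt]
    rw [← h]
    exact (ENNReal.continuous_ofReal.tendsto _).comp
      (Real.continuousAt_rpow_const _ _ (Or.inr hd.le)).tendsto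
  have hlt : D ^ d < D ^ d + ε :=
    ENNReal.lt_add_right (ENNReal.rpow_ne_top_of_nonneg hd.le hDt) hε
  obtain ⟨r, ⟨hr1, hr2⟩, hr3⟩ := (((hcont.eventually (gt_mem_nhds hlt)).and
    (gt_mem_nhds hD')).filter_mono nhdsWithin_le_nhds |>.and
    (self_mem_nhdsWithin : Ioi D.toReal ∈ nhdsWithin D.toReal (Ioi D.toReal))).exists
  exact ⟨r, ⟨D.toReal_nonneg.trans_lt hr3, hr2.le⟩, (ENNReal.lt_ofReal_iff_toReal_lt hDt).2 hr3,
    hr1.le⟩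

theorem exists_iUnion_ball_of_hausdorffMeasure_ne_top {X : Type*} [MetricSpace X] [Nonempty X]
    [MeasurableSpace X] [BorelSpace X] {d δ : ℝ} (hd : 0 < d) (hδ : 0 < δ) {A : Set X}
    (hA : μH[d] A ≠ ⊤) {ε : ℝ≥0∞} (hε : ε ≠ 0) :
    ∃ (c : ℕ → X) (r : ℕ → ℝ), (∀ i, r i ∈ Ioc 0 δ) ∧ A ⊆ ⋃ i, ball (c i) (r i) ∧
      ∑' i, ENNReal.ofReal (r i ^ d) ≤ μH[d] A + ε := by
  have hε2 : ε / 2 ≠ 0 := (ENNReal.half_pos hε).ne'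
  have h1 : (⨅ (t : ℕ → Set X) (_ : A ⊆ ⋃ n, t n) (_ : ∀ n, ediam (t n) ≤ ENNReal.ofReal (δ / 2)),
      ∑' n, ⨆ _ : (t n).Nonempty, ediam (t n) ^ d) < μH[d] A + ε / 2 := by
    refine lt_of_le_of_lt ?_ (ENNReal.lt_add_right hA hε2)
    rw [Measure.hausdorffMeasure_apply]
    exact le_iSup₂_of_le (ENNReal.ofReal (δ / 2)) (by simpa using hδ) le_rfl
  simp only [iInf_lt_iff] at h1
  obtain ⟨t, hAt, htd, htsum⟩ := h1
  obtain ⟨ε', hε'pos, hε'sum⟩ := ENNReal.exists_pos_sum_of_countable' hε2 ℕ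
  have hex : ∀ i, ∃ (c : X) (r : ℝ), r ∈ Ioc 0 δ ∧ t i ⊆ ball c r ∧
      ENNReal.ofReal (r ^ d) ≤ (⨆ _ : (t i).Nonempty, ediam (t i) ^ d) + ε' i := by
    intro i
    have hlt : ediam (t i) < ENNReal.ofReal δ :=
      (htd i).trans_lt ((ENNReal.ofReal_lt_ofReal_iff hδ).2 (by linarith))
    obtain ⟨r, hr, hr1, hr2⟩ := exists_radius_rpow_le hd (hε'pos i).ne' hlt
    rcases (t i).eq_empty_or_nonempty with he | hne
    · refine ⟨Classical.arbitrary X, r, hr, by simp [he], ?_⟩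
      simpa [he, ENNReal.zero_rpow_of_pos hd] using hr2
    · obtain ⟨c, hc⟩ := id hne
      refine ⟨c, r, hr, fun y hy => ?_, by simpa [hne] using hr2⟩
      have h := (edist_le_ediam_of_mem hy hc).trans_lt hr1
      rwa [edist_dist, ENNReal.ofReal_lt_ofReal_iff hr.1] at h
  choose c r hr ht hrd using hex
  refine ⟨c, r, hr, hAt.trans (iUnion_mono ht), ?_⟩
  calc _ ≤ ∑' i, ((⨆ _ : (t i).Nonempty, ediam (t i) ^ d) + ε' i) := ENNReal.tsum_le_tsum hrd
    _ = _ := ENNReal.tsum_add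
    _ ≤ μH[d] A + ε / 2 + ε / 2 := add_le_add htsum.le hε'sum.le
    _ = μH[d] A + ε := by rw [add_assoc, ENNReal.add_halves]

theorem restrict_ball_le_of_forall_mem {X : Type*} [MetricSpace X] [MeasurableSpace X]
    [BorelSpace X] {μ : Measure X} {S T : Set X} {n : ℕ} {C R : ℝ} (hTS : T ⊆ S)
    (h : ∀ x ∈ T, ∀ ρ ∈ Ioc 0 R, μ (S ∩ ball x ρ) ≤ ENNReal.ofReal (C * ρ ^ n))
    (x : X) {ρ : ℝ} (hρ : ρ ∈ Ioc 0 (R / 2)) :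
    μ.restrict T (ball x ρ) ≤ ENNReal.ofReal (C * 2 ^ n * ρ ^ n) := by
  rw [Measure.restrict_apply measurableSet_ball]
  rcases (ball x ρ ∩ T).eq_empty_or_nonempty with he | ⟨z, hz, hzT⟩
  · simp [he]
  calc μ (ball x ρ ∩ T) ≤ μ (S ∩ ball z (2 * ρ)) := by
        refine measure_mono fun y hy => ⟨hTS hy.2, ?_⟩
        have h1 := mem_ball.1 hy.1
        have h2 := mem_ball'.1 hz
        exact mem_ball.2 ((dist_triangle y x z).trans_lt (by linarith))
    _ ≤ ENNReal.ofReal (C * (2 * ρ) ^ n) := h z hzT _ ⟨by linarith [hρ.1], by linarith [hρ.2]⟩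
    _ = _ := by rw [mul_pow, mul_assoc]

/-- The `s`-fractional capacity is controlled by the `(n-2s)`-dimensional Hausdorff
measure (Proposition 3.9). -/
theorem capacity_le_hausdorff (n : ℕ) (hn : 2 ≤ n) (s : ℝ) (hs : s ∈ Ioo (1 / 2 : ℝ) 1)
    (Cstar : ℝ) (hCstar : 0 < Cstar) :
    ∃ C : ℝ, 0 < C ∧
      ∀ (S Ω : Set (EuclideanSpace ℝ (Fin (n + 1)))) (R : ℝ),
        (∀ x : EuclideanSpace ℝ (Fin (n + 1)), ∃ ε > 0, μH[(n : ℝ)] (S ∩ ball x ε) ≠ ⊤) →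
        IsOpen Ω → 0 < R →
        (∀ x ∈ S ∩ Ω, ∀ ρ ∈ Ioc (0 : ℝ) R,
          μH[(n : ℝ)] (S ∩ ball x ρ) ≤ ENNReal.ofReal (Cstar * ρ ^ n)) →
        ∀ A : Set (EuclideanSpace ℝ (Fin (n + 1))), A ⊆ S ∩ Ω →
          fracCapacity n s (S ∩ Ω) A ≤ ENNReal.ofReal C * μH[(n : ℝ) - 2 * s] A := by
  have hM : 0 < Cstar * 2 ^ n := by positivity
  have hK := kernelConst_nonneg (n := n) hs hM.le
  have hC : 0 < cutoffConst n s (Cstar * 2 ^ n) := by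
    rw [cutoffConst]
    positivity
  refine ⟨cutoffConst n s (Cstar * 2 ^ n), hC, fun S Ω R _ _ hR hS A _ => ?_⟩
  rcases eq_or_ne (μH[(n : ℝ) - 2 * s] A) ⊤ with hA | hA
  · rw [hA, ENNReal.mul_top (by simpa using hC)]
    exact le_top
  have hgrowth := fun x ρ => restrict_ball_le_of_forall_mem (μ := μH[(n : ℝ)])
    (inter_subset_left (s := S) (t := Ω)) hS x (ρ := ρ)
  have hfin : IsLocallyFiniteMeasure (μH[(n : ℝ)].restrict (S ∩ Ω)) := ⟨fun x =>
    ⟨ball x (R / 2), ball_mem_nhds x (by positivity),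
      (hgrowth x (R / 2) ⟨by positivity, le_rfl⟩).trans_lt ENNReal.ofReal_lt_top⟩⟩
  have hd : 0 < (n : ℝ) - 2 * s := by
    have : (2 : ℝ) ≤ n := by exact_mod_cast hn
    linarith [hs.2]
  set C' := ENNReal.ofReal (cutoffConst n s (Cstar * 2 ^ n))
  suffices h : ∀ ε : ℝ≥0, 0 < ε →
      fracCapacity n s (S ∩ Ω) A ≤ C' * (μH[(n : ℝ) - 2 * s] A + ε) by
    have hlim : Filter.Tendsto (fun ε : ℝ≥0 => C' * (μH[(n : ℝ) - 2 * s] A + ε))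
        (nhdsWithin 0 (Ioi 0)) (nhds (C' * (μH[(n : ℝ) - 2 * s] A + (0 : ℝ≥0)))) := by
      refine (Continuous.tendsto ?_ 0).mono_left nhdsWithin_le_nhds
      exact (ENNReal.continuous_const_mul ENNReal.ofReal_ne_top).comp
        (continuous_const.add ENNReal.continuous_coe)
    rw [ENNReal.coe_zero, add_zero] at hlim
    exact ge_of_tendsto hlim (Filter.eventually_of_mem self_mem_nhdsWithin h)
  intro ε hε
  obtain ⟨c, r, hr, hcover, hsum⟩ := exists_iUnion_ball_of_hausdorffMeasure_ne_top hd
    (δ := min 1 (R / 4)) (by positivity) hA (ENNReal.coe_ne_zero.2 hε.ne')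
  have hbdd : ∀ x, BddAbove (range fun i => cutoff (c i) (r i) x) := fun x =>
    ⟨1, forall_mem_range.2 fun i => cutoff_le_one _ _ x⟩
  have hnorm : sobolevNormSq n s (S ∩ Ω) (fun x => ⨆ i, cutoff (c i) (r i) x) ≤
      C' * (μH[(n : ℝ) - 2 * s] A + ε) := by
    calc _ ≤ ∑' i, sobolevNormSq n s (S ∩ Ω) (cutoff (c i) (r i)) :=
          sobolevNormSq_iSup_le n s _ (fun i => (continuous_cutoff _ _).measurable) hbdd
      _ ≤ ∑' i, C' * ENNReal.ofReal (r i ^ ((n : ℝ) - 2 * s)) :=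
          ENNReal.tsum_le_tsum fun i => sobolevNormSq_cutoff_le hs _ hM.le
            ⟨(hr i).1, (hr i).2.trans (min_le_left _ _)⟩ (fun x ρ hρ => hgrowth x ρ
              ⟨hρ.1, by linarith [hρ.2, (hr i).2.trans (min_le_right _ _)]⟩) (c i)
      _ ≤ _ := by
          rw [ENNReal.tsum_mul_left]
          gcongr
  refine (iInf₂_le _ ⟨Measurable.iSup fun i => (continuous_cutoff _ _).measurable, ?_,
    ⋃ i, ball (c i) (r i), isOpen_iUnion fun i => isOpen_ball, hcover, ?_⟩).trans hnorm
  · exact (hnorm.trans_lt (ENNReal.mul_lt_top ENNReal.ofReal_lt_top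
      (ENNReal.add_lt_top.2 ⟨hA.lt_top, ENNReal.coe_lt_top⟩))).ne
  · refine ae_mono (Measure.restrict_mono inter_subset_right le_rfl) (ae_restrict_of_forall_mem
      (isOpen_iUnion fun i => isOpen_ball).measurableSet fun x hx => ?_)
    obtain ⟨i, hi⟩ := mem_iUnion.1 hx
    rw [← cutoff_eq_one (hr i).1 hi]
    exact le_ciSup (hbdd x) i
end
end

section
/- Let n ≥ 1 be an integer, s ∈ (1/2, 1), Σ ⊆ ℝ^{n+1} a set with locally finite ℋⁿ-measure, Ω ⊆ ℝ^{n+1} an open set, x₀ ∈ Σ ∩ Ω, and R > 0. Assume that ℋⁿ(Σ ∩ B_ρ(x)) ≤ C⋆ ρⁿ holds for every x ∈ Σ ∩ Ω and every ρ ∈ (0, 2R], for some constant C⋆ > 0. Then there exists a constant C depending only on n, s, and C⋆, such that Cap_{Σ∩Ω, s}(Σ ∩ Ω ∩ B_r(x₀)) ≤ C r^{n−2s}(1 + r^{2s}) for every r ∈ (0, R). -/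
open MeasureTheory Metric Set
open scoped ENNReal NNReal

noncomputable section

theorem lintegral_ball_rpow_le {X : Type*} [NormedAddCommGroup X] [MeasurableSpace X]
    [OpensMeasurableSpace X] (ν : Measure X) (x : X) {n : ℕ} {A r s : ℝ} (hA : 0 ≤ A)
    (hr : 0 < r) (hs₀ : 0 < s) (hs₁ : s < 1)
    (h : ∀ ρ ∈ Ioc (0 : ℝ) (2 * r), ν (ball x ρ) ≤ ENNReal.ofReal (A * ρ ^ n)) :
    ∫⁻ y in ball x r, ENNReal.ofReal (‖x - y‖ ^ 2 * ‖x - y‖ ^ (-((n : ℝ) + 2 * s))) ∂ν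
      ≤ ENNReal.ofReal (A * 2 ^ n * 2 ^ ((n : ℝ) + 2 * s) * (1 - (1 / 2) ^ (2 - 2 * s))⁻¹
          * r ^ (2 - 2 * s)) := by
  set p : ℝ := (n : ℝ) + 2 * s with hp
  have hp0 : 0 < p := by positivity
  set q : ℝ := (1 / 2) ^ (2 - 2 * s) with hq
  have hq0 : 0 ≤ q := by positivity
  have hq1 : q < 1 := Real.rpow_lt_one (by norm_num) (by norm_num) (by linarith)
  let t : ℕ → ℝ := fun k => r * (1 / 2) ^ k
  have ht : ∀ k, 0 < t k := fun k => by positivity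
  have htr : ∀ k, t k ≤ r := fun k =>
    mul_le_of_le_one_right hr.le (pow_le_one₀ (by norm_num) (by norm_num))
  let c : ℕ → ℝ := fun k => t k ^ 2 * (t k / 2) ^ (-p)
  have hc : ∀ k, 0 ≤ c k := fun k => by have := ht k; positivity
  have hpt : ∀ y ∈ ball x r, ENNReal.ofReal (‖x - y‖ ^ 2 * ‖x - y‖ ^ (-p))
      ≤ ∑' k, (ball x (2 * t k)).indicator (fun _ => ENNReal.ofReal (c k)) y := by
    intro y hy
    rcases eq_or_ne x y with rfl | hxy
    · simp
    have hd : 0 < ‖x - y‖ := norm_pos_iff.2 (sub_ne_zero.2 hxy)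
    have hdr : ‖x - y‖ < r := by rwa [mem_ball, dist_comm, dist_eq_norm] at hy
    obtain ⟨k, hk1, hk2⟩ := exists_nat_pow_near_of_lt_one (x := ‖x - y‖ / r) (y := (1 / 2 : ℝ))
      (by positivity) ((div_le_one hr).2 hdr.le) (by norm_num) (by norm_num)
    have hk1' : t k / 2 < ‖x - y‖ := by
      rw [lt_div_iff₀ hr, pow_succ] at hk1
      simp only [t]; linarith
    have hk2' : ‖x - y‖ ≤ t k := by
      rw [div_le_iff₀ hr] at hk2
      simp only [t]; linarith
    refine le_trans ?_ (ENNReal.le_tsum k)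
    have hmem : y ∈ ball x (2 * t k) := by
      rw [mem_ball, dist_comm, dist_eq_norm]
      linarith [ht k]
    rw [indicator_of_mem hmem]
    refine ENNReal.ofReal_le_ofReal ?_
    have h1 : ‖x - y‖ ^ (-p) ≤ (t k / 2) ^ (-p) :=
      Real.rpow_le_rpow_of_nonpos (by linarith [ht k]) hk1'.le (by linarith)
    simp only [c]
    gcongr
  have hterm : ∀ k, c k * (A * (2 * t k) ^ n) = A * 2 ^ n * 2 ^ p * r ^ (2 - 2 * s) * q ^ k := by
    intro k
    have h1 : (t k) ^ (2 - 2 * s) = r ^ (2 - 2 * s) * q ^ k := by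
      simp only [t]
      rw [Real.mul_rpow hr.le (by positivity), hq, ← Real.rpow_natCast, ← Real.rpow_natCast,
        ← Real.rpow_mul (by norm_num), ← Real.rpow_mul (by norm_num), mul_comm (k : ℝ)]
    have h2 : t k ^ 2 * (t k) ^ (-p) * t k ^ n = t k ^ (2 - 2 * s) := by
      rw [← Real.rpow_natCast, ← Real.rpow_natCast, ← Real.rpow_add (ht k),
        ← Real.rpow_add (ht k)]
      congr 1
      simp only [hp]; push_cast; ring
    have h3 : (t k / 2) ^ (-p) = t k ^ (-p) * 2 ^ p := by
      rw [Real.div_rpow (ht k).le (by norm_num), Real.rpow_neg (by norm_num : (0 : ℝ) ≤ 2)]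
      field_simp
    rw [mul_assoc _ _ (q ^ k), ← h1, ← h2]
    simp only [c]
    rw [h3, mul_pow]
    ring
  calc ∫⁻ y in ball x r, ENNReal.ofReal (‖x - y‖ ^ 2 * ‖x - y‖ ^ (-p)) ∂ν
      ≤ ∫⁻ y in ball x r,
          ∑' k, (ball x (2 * t k)).indicator (fun _ => ENNReal.ofReal (c k)) y ∂ν :=
        setLIntegral_mono' measurableSet_ball hpt
    _ ≤ ∫⁻ y, ∑' k, (ball x (2 * t k)).indicator (fun _ => ENNReal.ofReal (c k)) y ∂ν :=
        setLIntegral_le_lintegral _ _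
    _ = ∑' k, ENNReal.ofReal (c k) * ν (ball x (2 * t k)) := by
        rw [lintegral_tsum fun k => (measurable_const.indicator measurableSet_ball).aemeasurable]
        simp_rw [lintegral_indicator_const measurableSet_ball]
    _ ≤ ∑' k, ENNReal.ofReal (A * 2 ^ n * 2 ^ p * r ^ (2 - 2 * s) * q ^ k) := by
        refine ENNReal.tsum_le_tsum fun k => ?_
        rw [← hterm, ENNReal.ofReal_mul (hc k)]
        gcongr
        exact h _ ⟨by linarith [ht k], by linarith [htr k]⟩
    _ = ENNReal.ofReal (A * 2 ^ n * 2 ^ p * (1 - q)⁻¹ * r ^ (2 - 2 * s)) := by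
        rw [← ENNReal.ofReal_tsum_of_nonneg (fun k => by positivity)
          ((summable_geometric_of_lt_one hq0 hq1).mul_left _), tsum_mul_left,
          tsum_geometric_of_lt_one hq0 hq1]
        congr 1
        ring

theorem lintegral_add_norm_sub_rpow {E : Type*} [NormedAddCommGroup E] [NormedSpace ℝ E]
    [FiniteDimensional ℝ E] [MeasurableSpace E] [BorelSpace E] (μ : Measure E)
    [μ.IsAddHaarMeasure] (x : E) {r : ℝ} (hr : 0 < r) (p : ℝ) :
    ∫⁻ z, ENNReal.ofReal ((r + ‖x - z‖) ^ (-p)) ∂μ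
      = ENNReal.ofReal (r ^ (-p)) * (ENNReal.ofReal (r ^ Module.finrank ℝ E)
        * ∫⁻ z, ENNReal.ofReal ((1 + ‖z‖) ^ (-p)) ∂μ) := by
  let g : E → ℝ≥0∞ := fun w => ENNReal.ofReal ((1 + ‖w‖) ^ (-p))
  have hg : Measurable g := by fun_prop
  have h1 : ∀ z, ENNReal.ofReal ((r + ‖x - z‖) ^ (-p))
      = ENNReal.ofReal (r ^ (-p)) * g (r⁻¹ • (x - z)) := by
    intro z
    simp only [g]
    rw [← ENNReal.ofReal_mul (by positivity), ← Real.mul_rpow hr.le (by positivity), norm_smul,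
      Real.norm_of_nonneg (by positivity)]
    congr 2
    field_simp
  simp_rw [h1]
  rw [lintegral_const_mul _ (by fun_prop), lintegral_sub_left_eq_self (fun z => g (r⁻¹ • z)) x,
    ← lintegral_map hg (by fun_prop), Measure.map_addHaar_smul _ (inv_ne_zero hr.ne'),
    lintegral_smul_measure, inv_pow, inv_inv, abs_of_nonneg (by positivity), smul_eq_mul]

theorem lintegral_compl_ball_rpow_le {E : Type*} [NormedAddCommGroup E] [NormedSpace ℝ E]
    [FiniteDimensional ℝ E] [MeasurableSpace E] [BorelSpace E] (μ : Measure E)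
    [μ.IsAddHaarMeasure] (ν : Measure E) [SFinite ν] (x : E) {r p : ℝ} (hr : 0 < r)
    (hp : 0 ≤ p) {M : ℝ≥0∞} (h : ∀ z, ν (ball z r) ≤ M) :
    ∫⁻ y in (ball x r)ᶜ, ENNReal.ofReal (‖x - y‖ ^ (-p)) ∂ν
      ≤ (μ (ball 0 1))⁻¹ * ENNReal.ofReal (3 ^ p) *
          (∫⁻ z, ENNReal.ofReal ((1 + ‖z‖) ^ (-p)) ∂μ) * (M * ENNReal.ofReal (r ^ (-p))) := by
  set I := ∫⁻ z, ENNReal.ofReal ((1 + ‖z‖) ^ (-p)) ∂μ with hI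
  set d := Module.finrank ℝ E
  have hd : ENNReal.ofReal (r ^ d) ≠ 0 := by simpa using pow_pos hr d
  let K : E → ℝ≥0∞ := fun z => ENNReal.ofReal (3 ^ p * (r + ‖x - z‖) ^ (-p))
  have hK : Measurable K := by fun_prop
  have hpt : ∀ y ∈ (ball x r)ᶜ, μ (ball 0 1) * ENNReal.ofReal (r ^ d)
      * ENNReal.ofReal (‖x - y‖ ^ (-p)) ≤ ∫⁻ z, (ball y r).indicator K z ∂μ := by
    intro y hy
    have hy' : r ≤ ‖x - y‖ := by
      rwa [mem_compl_iff, mem_ball, not_lt, dist_comm, dist_eq_norm] at hy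
    rw [lintegral_indicator measurableSet_ball, mul_comm (μ _), ← Measure.addHaar_ball_of_pos μ y hr,
      mul_comm, ← setLIntegral_const]
    refine setLIntegral_mono' measurableSet_ball fun z hz => ENNReal.ofReal_le_ofReal ?_
    have hz' : ‖y - z‖ < r := by rwa [mem_ball, dist_comm, dist_eq_norm] at hz
    have h3 : ‖x - z‖ ≤ ‖x - y‖ + ‖y - z‖ := norm_sub_le_norm_sub_add_norm_sub x y z
    have h4 : ‖x - y‖ ^ (-p) = 3 ^ p * (3 * ‖x - y‖) ^ (-p) := by
      rw [Real.mul_rpow (by norm_num) (norm_nonneg _), ← mul_assoc,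
        ← Real.rpow_add (by norm_num), add_neg_cancel, Real.rpow_zero, one_mul]
    rw [h4]
    gcongr 3 ^ p * ?_
    exact Real.rpow_le_rpow_of_nonpos (by positivity) (by linarith) (by linarith)
  have hmeas : Measurable (Function.uncurry fun y z => (ball y r).indicator K z) := by
    have : (Function.uncurry fun y z => (ball y r).indicator K z)
        = {w : E × E | dist w.2 w.1 < r}.indicator (fun w => K w.2) := by
      ext ⟨y, z⟩
      simp [indicator, Function.uncurry]
    rw [this]
    exact (hK.comp measurable_snd).indicator
      (measurableSet_lt (by fun_prop) measurable_const)
  have hmain : μ (ball 0 1) * ENNReal.ofReal (r ^ d)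
      * ∫⁻ y in (ball x r)ᶜ, ENNReal.ofReal (‖x - y‖ ^ (-p)) ∂ν
      ≤ ENNReal.ofReal (r ^ d) *
        (ENNReal.ofReal (3 ^ p) * I * (M * ENNReal.ofReal (r ^ (-p)))) := by
    calc μ (ball 0 1) * ENNReal.ofReal (r ^ d)
          * ∫⁻ y in (ball x r)ᶜ, ENNReal.ofReal (‖x - y‖ ^ (-p)) ∂ν
        = ∫⁻ y in (ball x r)ᶜ, μ (ball 0 1) * ENNReal.ofReal (r ^ d)
            * ENNReal.ofReal (‖x - y‖ ^ (-p)) ∂ν := (lintegral_const_mul _ (by fun_prop)).symm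
      _ ≤ ∫⁻ y in (ball x r)ᶜ, ∫⁻ z, (ball y r).indicator K z ∂μ ∂ν :=
          setLIntegral_mono' measurableSet_ball.compl hpt
      _ ≤ ∫⁻ y, ∫⁻ z, (ball y r).indicator K z ∂μ ∂ν := setLIntegral_le_lintegral _ _
      _ = ∫⁻ z, ∫⁻ y, (ball y r).indicator K z ∂ν ∂μ :=
          lintegral_lintegral_swap hmeas.aemeasurable
      _ = ∫⁻ z, K z * ν (ball z r) ∂μ := by
          refine lintegral_congr fun z => ?_
          rw [← lintegral_indicator_const measurableSet_ball]
          refine lintegral_congr fun y => ?_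
          simp [indicator, dist_comm]
      _ ≤ ∫⁻ z, K z * M ∂μ := by gcongr; exact h _
      _ = _ := by
          rw [lintegral_mul_const _ hK]
          simp only [K, ENNReal.ofReal_mul (show (0 : ℝ) ≤ 3 ^ p by positivity)]
          rw [lintegral_const_mul _ (by fun_prop), lintegral_add_norm_sub_rpow μ x hr]
          ring
  rw [mul_comm (μ _), mul_assoc, ENNReal.mul_le_mul_iff_right hd ENNReal.ofReal_ne_top] at hmain
  have hμ0 : μ (ball 0 1) ≠ 0 := (measure_ball_pos μ 0 one_pos).ne'
  have hμt : μ (ball 0 1) ≠ ⊤ := measure_ball_lt_top.ne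
  calc _ = (μ (ball 0 1))⁻¹ * (μ (ball 0 1)
        * ∫⁻ y in (ball x r)ᶜ, ENNReal.ofReal (‖x - y‖ ^ (-p)) ∂ν) := by
        rw [← mul_assoc, ENNReal.inv_mul_cancel hμ0 hμt, one_mul]
    _ ≤ (μ (ball 0 1))⁻¹ * (ENNReal.ofReal (3 ^ p) * I * (M * ENNReal.ofReal (r ^ (-p)))) := by
        gcongr
    _ = _ := by simp only [mul_assoc]

theorem lintegral_lintegral_le_two_mul_of_symm {X : Type*} [MeasurableSpace X] (ν : Measure X)
    [SFinite ν] {F : X → X → ℝ≥0∞} (hF : Measurable (Function.uncurry F))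
    (hsymm : ∀ x y, F x y = F y x) {B : Set X} (hB : MeasurableSet B)
    (hzero : ∀ x ∉ B, ∀ y ∉ B, F x y = 0) :
    ∫⁻ x, ∫⁻ y, F x y ∂ν ∂ν ≤ 2 * ∫⁻ x in B, ∫⁻ y, F x y ∂ν ∂ν := by
  have hG : Measurable fun x => ∫⁻ y, F x y ∂ν := hF.lintegral_prod_right'
  have hright : ∀ x, ∫⁻ y, F x y ∂ν ≤ B.indicator (fun x => ∫⁻ y, F x y ∂ν) x
      + ∫⁻ y in B, F x y ∂ν := by
    intro x
    by_cases hx : x ∈ B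
    · rw [indicator_of_mem hx]; exact le_self_add
    · rw [indicator_of_notMem hx, zero_add, ← lintegral_indicator hB]
      refine lintegral_mono fun y => ?_
      by_cases hy : y ∈ B
      · rw [indicator_of_mem hy]
      · rw [indicator_of_notMem hy, hzero x hx y hy]
  calc ∫⁻ x, ∫⁻ y, F x y ∂ν ∂ν
      ≤ ∫⁻ x, (B.indicator (fun x => ∫⁻ y, F x y ∂ν) x + ∫⁻ y in B, F x y ∂ν) ∂ν :=
        lintegral_mono hright
    _ = ∫⁻ x in B, ∫⁻ y, F x y ∂ν ∂ν + ∫⁻ x, ∫⁻ y in B, F x y ∂ν ∂ν := by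
        rw [lintegral_add_left (hG.indicator hB), lintegral_indicator hB]
    _ = ∫⁻ x in B, ∫⁻ y, F x y ∂ν ∂ν + ∫⁻ y in B, ∫⁻ x, F x y ∂ν ∂ν := by
        rw [lintegral_lintegral_swap (μ := ν) (ν := ν.restrict B) hF.aemeasurable]
    _ = 2 * ∫⁻ x in B, ∫⁻ y, F x y ∂ν ∂ν := by
        rw [two_mul]
        simp_rw [hsymm]

/-- The radial cutoff equal to `1` on `ball x₀ r` and to `0` outside `ball x₀ (2 * r)`. -/
def radialCutoff {E : Type*} [NormedAddCommGroup E] (x₀ : E) (r : ℝ) (x : E) : ℝ :=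
  max 0 (min 1 (2 - ‖x - x₀‖ / r))

section radialCutoff

variable {E : Type*} [NormedAddCommGroup E] (x₀ : E) {r : ℝ}

theorem measurable_radialCutoff [MeasurableSpace E] [OpensMeasurableSpace E] (r : ℝ) :
    Measurable (radialCutoff x₀ r) := by
  have : Continuous (radialCutoff x₀ r) := by unfold radialCutoff; fun_prop
  exact this.measurable

theorem radialCutoff_nonneg (r : ℝ) (x : E) : 0 ≤ radialCutoff x₀ r x := le_max_left _ _

theorem radialCutoff_le_one (r : ℝ) (x : E) : radialCutoff x₀ r x ≤ 1 :=
  max_le zero_le_one (min_le_left _ _)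

theorem one_le_radialCutoff (hr : 0 < r) {x : E} (hx : x ∈ ball x₀ r) :
    1 ≤ radialCutoff x₀ r x := by
  rw [mem_ball, dist_eq_norm] at hx
  have := (div_le_one hr).2 hx.le
  exact le_max_of_le_right (le_min le_rfl (by linarith))

theorem radialCutoff_eq_zero (hr : 0 < r) {x : E} (hx : x ∉ ball x₀ (2 * r)) :
    radialCutoff x₀ r x = 0 := by
  rw [mem_ball, dist_eq_norm, not_lt, ← le_div_iff₀ hr] at hx
  exact max_eq_left ((min_le_right _ _).trans (by linarith))

theorem sq_radialCutoff_sub_le_one (r : ℝ) (x y : E) :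
    (radialCutoff x₀ r x - radialCutoff x₀ r y) ^ 2 ≤ 1 := by
  rw [sq_le_one_iff_abs_le_one, abs_le]
  constructor <;>
  linarith [radialCutoff_nonneg x₀ r x, radialCutoff_nonneg x₀ r y, radialCutoff_le_one x₀ r x,
    radialCutoff_le_one x₀ r y]

theorem sq_radialCutoff_sub_le (hr : 0 < r) (x y : E) :
    (radialCutoff x₀ r x - radialCutoff x₀ r y) ^ 2 ≤ (r ^ 2)⁻¹ * ‖x - y‖ ^ 2 := by
  have h : |radialCutoff x₀ r x - radialCutoff x₀ r y| ≤ ‖x - y‖ / r := by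
    unfold radialCutoff
    calc _ ≤ |min 1 (2 - ‖x - x₀‖ / r) - min 1 (2 - ‖y - x₀‖ / r)| := by
          simpa using abs_max_sub_max_le_max (0 : ℝ) (min 1 (2 - ‖x - x₀‖ / r)) 0
            (min 1 (2 - ‖y - x₀‖ / r))
      _ ≤ |(2 - ‖x - x₀‖ / r) - (2 - ‖y - x₀‖ / r)| := by
          simpa using abs_min_sub_min_le_max (1 : ℝ) (2 - ‖x - x₀‖ / r) 1 (2 - ‖y - x₀‖ / r)
      _ = |‖y - x₀‖ - ‖x - x₀‖| / r := by
          rw [← abs_of_pos hr, ← abs_div, abs_of_pos hr]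
          congr 1
          ring
      _ ≤ ‖x - y‖ / r := by
          gcongr
          simpa [norm_sub_rev] using abs_norm_sub_norm_le (y - x₀) (x - x₀)
  calc _ = |radialCutoff x₀ r x - radialCutoff x₀ r y| ^ 2 := (sq_abs _).symm
    _ ≤ (‖x - y‖ / r) ^ 2 := by gcongr
    _ = _ := by rw [div_pow, div_eq_inv_mul]

end radialCutoff

theorem isLocallyFiniteMeasure_restrict {X : Type*} [PseudoMetricSpace X] [MeasurableSpace X]
    [OpensMeasurableSpace X] {μ : Measure X} {T : Set X}
    (h : ∀ x : X, ∃ ε > 0, μ (T ∩ ball x ε) ≠ ⊤) : IsLocallyFiniteMeasure (μ.restrict T) := by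
  refine ⟨fun x => ?_⟩
  obtain ⟨ε, hε, hx⟩ := h x
  refine ⟨ball x ε, ball_mem_nhds x hε, ?_⟩
  rw [Measure.restrict_apply measurableSet_ball, inter_comm]
  exact hx.lt_top

theorem measure_ball_le_of_forall_mem {X : Type*} [PseudoMetricSpace X] [MeasurableSpace X]
    [OpensMeasurableSpace X] {μ : Measure X} {T : Set X} {r : ℝ} {M : ℝ≥0∞}
    (h : ∀ x ∈ T, μ.restrict T (ball x (2 * r)) ≤ M) (z : X) :
    μ.restrict T (ball z r) ≤ M := by
  rcases (ball z r ∩ T).eq_empty_or_nonempty with he | ⟨w, hw, hwT⟩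
  · rw [Measure.restrict_apply measurableSet_ball, he, measure_empty]
    exact zero_le
  · refine (measure_mono (ball_subset_ball' ?_)).trans (h w hwT)
    rw [mem_ball, dist_comm] at hw
    linarith

/-- Sharp upper bound for the `s`-fractional capacity of ambient balls (Lemma 3.11). -/
theorem capacity_of_balls (n : ℕ) (hn : 1 ≤ n) (s : ℝ) (hs : s ∈ Ioo (1 / 2 : ℝ) 1)
    (Cstar : ℝ) (hCstar : 0 < Cstar) :
    ∃ C : ℝ, 0 < C ∧
      ∀ (S Ω : Set (EuclideanSpace ℝ (Fin (n + 1))))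
        (x₀ : EuclideanSpace ℝ (Fin (n + 1))) (R : ℝ),
        (∀ x : EuclideanSpace ℝ (Fin (n + 1)), ∃ ε > 0, μH[(n : ℝ)] (S ∩ ball x ε) ≠ ⊤) →
        IsOpen Ω → x₀ ∈ S ∩ Ω → 0 < R →
        (∀ x ∈ S ∩ Ω, ∀ ρ ∈ Ioc (0 : ℝ) (2 * R),
          μH[(n : ℝ)] (S ∩ ball x ρ) ≤ ENNReal.ofReal (Cstar * ρ ^ n)) →
        ∀ r ∈ Ioo (0 : ℝ) R,
          fracCapacity n s (S ∩ Ω) (S ∩ Ω ∩ ball x₀ r)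
            ≤ ENNReal.ofReal (C * r ^ ((n : ℝ) - 2 * s) * (1 + r ^ (2 * s))) := by
  obtain ⟨hs₁, hs₂⟩ := hs
  set p : ℝ := (n : ℝ) + 2 * s with hp
  have hp0 : 0 < p := by positivity
  set K₁ : ℝ := Cstar * 2 ^ n * 2 ^ p * (1 - (1 / 2) ^ (2 - 2 * s))⁻¹ with hK₁
  have hK₁0 : 0 ≤ K₁ := by
    have : ((1 : ℝ) / 2) ^ (2 - 2 * s) ≤ 1 :=
      Real.rpow_le_one (by norm_num) (by norm_num) (by linarith)
    have : 0 ≤ (1 - ((1 : ℝ) / 2) ^ (2 - 2 * s))⁻¹ := inv_nonneg.2 (by linarith)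
    positivity
  let K : ℝ≥0∞ := (volume (ball (0 : EuclideanSpace ℝ (Fin (n + 1))) 1))⁻¹
    * ENNReal.ofReal (3 ^ p)
    * ∫⁻ z : EuclideanSpace ℝ (Fin (n + 1)), ENNReal.ofReal ((1 + ‖z‖) ^ (-p))
  have hK : K ≠ ⊤ := by
    refine ENNReal.mul_ne_top (ENNReal.mul_ne_top ?_ ENNReal.ofReal_ne_top) ?_
    · exact ENNReal.inv_ne_top.2 (measure_ball_pos _ _ one_pos).ne'
    · refine (finite_integral_one_add_norm ?_).ne
      rw [finrank_euclideanSpace_fin, hp]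
      push_cast
      linarith
  set K₂ : ℝ := K.toReal
  have hK₂ : K = ENNReal.ofReal K₂ := (ENNReal.ofReal_toReal hK).symm
  have hK₂0 : 0 ≤ K₂ := ENNReal.toReal_nonneg
  set K₃ : ℝ := K₁ + K₂ * (Cstar * 2 ^ n) with hK₃
  have hK₃0 : 0 ≤ K₃ := by positivity
  refine ⟨Cstar * 2 ^ n * (1 + 2 * K₃), by positivity, ?_⟩
  intro S Ω x₀ R hfin _ hx₀ hR hgrowth r ⟨hr, hrR⟩
  set T := S ∩ Ω
  set ν := (μH[(n : ℝ)] : Measure (EuclideanSpace ℝ (Fin (n + 1)))).restrict T with hν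
  have : IsLocallyFiniteMeasure ν := isLocallyFiniteMeasure_restrict fun x => by
    obtain ⟨ε, hε, h⟩ := hfin x
    exact ⟨ε, hε, ne_top_of_le_ne_top h
      (measure_mono (inter_subset_inter_left _ inter_subset_left))⟩
  have hball : ∀ x ∈ T, ∀ ρ ∈ Ioc (0 : ℝ) (2 * r), ν (ball x ρ) ≤ ENNReal.ofReal (Cstar * ρ ^ n) := by
    intro x hx ρ hρ
    rw [hν, Measure.restrict_apply measurableSet_ball, inter_comm]
    exact (measure_mono (inter_subset_inter_left _ inter_subset_left)).trans
      (hgrowth x hx ρ ⟨hρ.1, by linarith [hρ.2]⟩)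
  have hball₂ : ∀ x ∈ T, ν (ball x (2 * r)) ≤ ENNReal.ofReal (Cstar * (2 * r) ^ n) :=
    fun x hx => hball x hx _ ⟨by positivity, le_rfl⟩
  set v := radialCutoff x₀ r
  have hv : Measurable v := measurable_radialCutoff x₀ r
  let F : EuclideanSpace ℝ (Fin (n + 1)) → EuclideanSpace ℝ (Fin (n + 1)) → ℝ≥0∞ :=
    fun x y => ENNReal.ofReal ((v x - v y) ^ 2 * ‖x - y‖ ^ (-p))
  have hF : Measurable (Function.uncurry F) := by
    simp only [F, Function.uncurry_def]
    fun_prop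
  have hinner : ∀ x ∈ T, ∫⁻ y, F x y ∂ν ≤ ENNReal.ofReal (K₃ * r ^ (-(2 * s))) := by
    intro x hx
    have hnear : ∫⁻ y in ball x r, F x y ∂ν
        ≤ ENNReal.ofReal ((r ^ 2)⁻¹ * (K₁ * r ^ (2 - 2 * s))) := by
      calc ∫⁻ y in ball x r, F x y ∂ν
          ≤ ∫⁻ y in ball x r, ENNReal.ofReal (r ^ 2)⁻¹
              * ENNReal.ofReal (‖x - y‖ ^ 2 * ‖x - y‖ ^ (-p)) ∂ν := by
            refine lintegral_mono fun y => ?_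
            rw [← ENNReal.ofReal_mul (by positivity), ← mul_assoc]
            refine ENNReal.ofReal_le_ofReal ?_
            gcongr
            exact sq_radialCutoff_sub_le x₀ hr x y
        _ ≤ _ := by
            rw [lintegral_const_mul _ (by fun_prop), ENNReal.ofReal_mul (by positivity)]
            gcongr
            exact lintegral_ball_rpow_le ν x hCstar.le hr (by linarith) hs₂ (hball x hx)
    have hfar : ∫⁻ y in (ball x r)ᶜ, F x y ∂ν
        ≤ ENNReal.ofReal (K₂ * (Cstar * (2 * r) ^ n * r ^ (-p))) := by
      calc ∫⁻ y in (ball x r)ᶜ, F x y ∂ν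
          ≤ ∫⁻ y in (ball x r)ᶜ, ENNReal.ofReal (‖x - y‖ ^ (-p)) ∂ν := by
            refine lintegral_mono fun y => ENNReal.ofReal_le_ofReal ?_
            exact mul_le_of_le_one_left (by positivity) (sq_radialCutoff_sub_le_one x₀ r x y)
        _ ≤ K * (ENNReal.ofReal (Cstar * (2 * r) ^ n) * ENNReal.ofReal (r ^ (-p))) :=
            lintegral_compl_ball_rpow_le volume ν x hr hp0.le
              (measure_ball_le_of_forall_mem hball₂)
        _ = _ := by
            rw [hK₂, ← ENNReal.ofReal_mul (by positivity), ← ENNReal.ofReal_mul hK₂0]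
    rw [← lintegral_add_compl _ (measurableSet_ball (x := x) (ε := r))]
    refine (add_le_add hnear hfar).trans ?_
    rw [← ENNReal.ofReal_add (by positivity) (by positivity)]
    refine ENNReal.ofReal_le_ofReal (le_of_eq ?_)
    have e₁ : (r ^ 2)⁻¹ * r ^ (2 - 2 * s) = r ^ (-(2 * s)) := by
      rw [← Real.rpow_natCast, ← Real.rpow_neg hr.le, ← Real.rpow_add hr]
      congr 1
      push_cast
      ring
    have e₂ : r ^ n * r ^ (-p) = r ^ (-(2 * s)) := by
      rw [← Real.rpow_natCast, ← Real.rpow_add hr, hp]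
      congr 1
      ring
    rw [hK₃, mul_pow]
    linear_combination K₁ * e₁ + K₂ * Cstar * 2 ^ n * e₂
  have hL2 : ∫⁻ x, ENNReal.ofReal (v x ^ 2) ∂ν ≤ ENNReal.ofReal (Cstar * (2 * r) ^ n) := by
    refine le_trans ?_ (hball₂ x₀ hx₀)
    rw [← lintegral_indicator_one measurableSet_ball]
    refine lintegral_mono fun x => ?_
    by_cases hx : x ∈ ball x₀ (2 * r)
    · rw [indicator_of_mem hx, Pi.one_apply, ENNReal.ofReal_le_one]
      exact pow_le_one₀ (radialCutoff_nonneg x₀ r x) (radialCutoff_le_one x₀ r x)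
    · simp [v, radialCutoff_eq_zero x₀ hr hx]
  have hsemi : ∫⁻ x, ∫⁻ y, F x y ∂ν ∂ν
      ≤ 2 * (ENNReal.ofReal (K₃ * r ^ (-(2 * s))) * ENNReal.ofReal (Cstar * (2 * r) ^ n)) := by
    refine (lintegral_lintegral_le_two_mul_of_symm ν hF (fun x y => ?_)
      (measurableSet_ball (x := x₀) (ε := 2 * r)) fun x hx y hy => ?_).trans ?_
    · simp only [F]
      rw [norm_sub_rev, ← neg_sub (v y), neg_sq]
    · simp [F, v, radialCutoff_eq_zero x₀ hr hx, radialCutoff_eq_zero x₀ hr hy]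
    · have hae : ∀ᵐ x ∂ν, ∫⁻ y, F x y ∂ν ≤ ENNReal.ofReal (K₃ * r ^ (-(2 * s))) :=
        (ae_restrict_iff (measurableSet_le hF.lintegral_prod_right' measurable_const)).2
          (Filter.Eventually.of_forall hinner)
      gcongr
      calc _ ≤ ∫⁻ _ in ball x₀ (2 * r), ENNReal.ofReal (K₃ * r ^ (-(2 * s))) ∂ν :=
            lintegral_mono_ae (ae_restrict_of_ae hae)
        _ ≤ _ := by
            rw [setLIntegral_const]
            gcongr
            exact hball₂ x₀ hx₀
  have hnorm : sobolevNormSq n s T v ≤ ENNReal.ofReal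
      (Cstar * 2 ^ n * (1 + 2 * K₃) * r ^ ((n : ℝ) - 2 * s) * (1 + r ^ (2 * s))) := by
    refine (add_le_add hL2 hsemi).trans ?_
    rw [← ENNReal.ofReal_mul (by positivity), ← ENNReal.ofReal_ofNat 2,
      ← ENNReal.ofReal_mul (by positivity), ← ENNReal.ofReal_add (by positivity) (by positivity)]
    refine ENNReal.ofReal_le_ofReal ?_
    have e₁ : r ^ (-(2 * s)) * r ^ n = r ^ ((n : ℝ) - 2 * s) := by
      rw [← Real.rpow_natCast, ← Real.rpow_add hr]
      congr 1
      ring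
    have e₂ : r ^ ((n : ℝ) - 2 * s) * r ^ (2 * s) = r ^ n := by
      rw [← Real.rpow_add hr, sub_add_cancel, Real.rpow_natCast]
    have h₁ : 0 ≤ Cstar * 2 ^ n * r ^ ((n : ℝ) - 2 * s) := by positivity
    have h₂ : 0 ≤ Cstar * 2 ^ n * (2 * K₃) * r ^ n := by positivity
    calc _ = Cstar * 2 ^ n * r ^ n + Cstar * 2 ^ n * (2 * K₃) * r ^ ((n : ℝ) - 2 * s) := by
          rw [← e₁, mul_pow]; ring
      _ ≤ Cstar * 2 ^ n * (1 + 2 * K₃) * r ^ ((n : ℝ) - 2 * s)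
            + Cstar * 2 ^ n * (1 + 2 * K₃) * r ^ n := by linarith
      _ = _ := by rw [← e₂]; ring
  refine (iInf₂_le v ⟨hv, ne_top_of_le_ne_top ENNReal.ofReal_ne_top hnorm, ball x₀ r, isOpen_ball,
    inter_subset_right, ?_⟩).trans hnorm
  exact (ae_restrict_iff (measurableSet_le measurable_const hv)).2
    (Filter.Eventually.of_forall fun x hx => one_le_radialCutoff x₀ hr hx.2)
end
end
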